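/- arXiv:2311.11127 — 3 statements merged into one kernel-verified Lean document; each statement's English description precedes it below -/
import Mathlib

section
/- Let P be a set of prime numbers such that the sum of 1/p over all primes p not in P is finite. Let α be a real number with α > 1 and α not an integer. Let B be the multiplicative submonoid of the reals generated by {(p : ℝ) : p ∈ P} ∪ {α}. Then for every δ > 0 there exist distinct elements x, y ∈ B with |x − y| < δ (i.e., the infimum of gaps between distinct elements of B is 0). -/
open MeasureTheory

open Classical in
/-- Sieve lemma. -/
lemma sieve_aux (Q : Set ℕ)
    (htail : ∀ η > (0 : ℝ), ∃ z : ℕ, ∀ F : Finset ℕ, (∀ q ∈ F, q ∈ Q ∧ z < q) →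
      ∑ q ∈ F, (1 : ℝ) / q ≤ η)
    (A : Set ℕ) (Bad : ℕ → ℕ → Prop) (z0 : ℕ) (c C0 D w : ℝ) (hc : 0 < c) (hD : 0 < D)
    (hA : ∀ T : ℕ, c * T - C0 ≤ ((Finset.range T).filter (fun t => t ∈ A)).card)
    (h1 : ∀ q ∈ Q, q ≤ z0 → ∀ t ∈ A, ¬ Bad q t)
    (h2 : ∀ q ∈ Q, z0 < q → ∃ C : ℝ, ∀ T : ℕ,
      (((Finset.range T).filter (fun t => t ∈ A ∧ Bad q t)).card : ℝ) ≤ w / q * T + C)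
    (h3 : ∀ q ∈ Q, z0 < q → ∀ T : ℕ,
      (((Finset.range T).filter (fun t => t ∈ A ∧ Bad q t)).card : ℝ) ≤ D * (T + 1) / q)
    (hw : ∀ F : Finset ℕ, (∀ q ∈ F, q ∈ Q ∧ z0 < q) → ∑ q ∈ F, w / q ≤ c / 2) :
    ∃ t ∈ A, ∀ q ∈ Q, ¬ Bad q t := by
  by_contra hcon
  push Not at hcon
  have hcon' : ∀ t, ∃ q, t ∈ A → q ∈ Q ∧ Bad q t := by
    intro t
    by_cases ht : t ∈ A
    · obtain ⟨q, hq⟩ := hcon t ht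
      exact ⟨q, fun _ => hq⟩
    · exact ⟨0, fun h => absurd h ht⟩
  choose qf hqf using hcon'
  have h2' : ∀ q, ∃ C : ℝ, q ∈ Q → z0 < q → ∀ T : ℕ,
      (((Finset.range T).filter (fun t => t ∈ A ∧ Bad q t)).card : ℝ) ≤ w / q * T + C := by
    intro q
    by_cases h : q ∈ Q ∧ z0 < q
    · obtain ⟨C, hC⟩ := h2 q h.1 h.2
      exact ⟨C, fun _ _ => hC⟩
    · exact ⟨0, fun h3 h4 => absurd ⟨h3, h4⟩ h⟩
  choose C hC using h2'
  obtain ⟨z1, hz1⟩ := htail (c / (4 * D)) (by positivity)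
  set F1 := (Finset.range (z1 + 1)).filter (fun q => q ∈ Q ∧ z0 < q) with hF1
  set C1 := ∑ q ∈ F1, C q with hC1
  have key : ∀ T : ℕ, c * T - C0 ≤ c / 2 * T + C1 + c / 4 * (T + 1) := by
    intro T
    refine (hA T).trans ?_
    set F2 := (((Finset.range T).filter (fun t => t ∈ A)).image qf).filter
      (fun q => z1 < q) with hF2
    have hF2Q : ∀ q ∈ F2, q ∈ Q ∧ z0 < q ∧ z1 < q := by
      intro q hq
      simp only [hF2, Finset.mem_filter, Finset.mem_image, Finset.mem_range] at hq
      obtain ⟨⟨t, ⟨_, htA⟩, rfl⟩, hz⟩ := hq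
      refine ⟨(hqf t htA).1, ?_, hz⟩
      by_contra h
      exact h1 _ (hqf t htA).1 (not_lt.mp h) t htA (hqf t htA).2
    have hsub : (Finset.range T).filter (fun t => t ∈ A) ⊆
        (F1.biUnion (fun q => (Finset.range T).filter (fun t => t ∈ A ∧ Bad q t))) ∪
        (F2.biUnion (fun q => (Finset.range T).filter (fun t => t ∈ A ∧ Bad q t))) := by
      intro t ht
      have ht' := ht
      simp only [Finset.mem_filter, Finset.mem_range] at ht'
      obtain ⟨hT, htA⟩ := ht'
      have hz0 : z0 < qf t := by
        by_contra h
        exact h1 _ (hqf t htA).1 (not_lt.mp h) t htA (hqf t htA).2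
      simp only [Finset.mem_union, Finset.mem_biUnion]
      by_cases hz : z1 < qf t
      · right
        refine ⟨qf t, ?_, ?_⟩
        · rw [hF2, Finset.mem_filter]
          exact ⟨Finset.mem_image_of_mem _ ht, hz⟩
        · simp only [Finset.mem_filter, Finset.mem_range]
          exact ⟨hT, htA, (hqf t htA).2⟩
      · left
        refine ⟨qf t, ?_, ?_⟩
        · rw [hF1, Finset.mem_filter, Finset.mem_range]
          exact ⟨by omega, (hqf t htA).1, hz0⟩
        · simp only [Finset.mem_filter, Finset.mem_range]
          exact ⟨hT, htA, (hqf t htA).2⟩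
    have hcard := (Finset.card_le_card hsub).trans ((Finset.card_union_le _ _).trans
      (add_le_add Finset.card_biUnion_le Finset.card_biUnion_le))
    have hcard' : ((((Finset.range T).filter (fun t => t ∈ A)).card : ℕ) : ℝ) ≤
        ∑ q ∈ F1, (((Finset.range T).filter (fun t => t ∈ A ∧ Bad q t)).card : ℝ) +
        ∑ q ∈ F2, (((Finset.range T).filter (fun t => t ∈ A ∧ Bad q t)).card : ℝ) := by
      exact_mod_cast hcard
    have hs1 : ∑ q ∈ F1, (((Finset.range T).filter (fun t => t ∈ A ∧ Bad q t)).card : ℝ) ≤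
        c / 2 * T + C1 := by
      have hF1' : ∀ q ∈ F1, q ∈ Q ∧ z0 < q := fun q hq => (Finset.mem_filter.mp hq).2
      calc _ ≤ ∑ q ∈ F1, (w / q * T + C q) :=
            Finset.sum_le_sum (fun q hq => hC q (hF1' q hq).1 (hF1' q hq).2 T)
        _ = (∑ q ∈ F1, w / q) * T + C1 := by
            rw [Finset.sum_add_distrib, Finset.sum_mul]
        _ ≤ _ := by
            have := hw F1 hF1'
            gcongr
    have hs2 : ∑ q ∈ F2, (((Finset.range T).filter (fun t => t ∈ A ∧ Bad q t)).card : ℝ) ≤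
        c / 4 * (T + 1) := by
      calc _ ≤ ∑ q ∈ F2, (D * (T + 1)) * (1 / q) := by
            refine Finset.sum_le_sum (fun q hq => ?_)
            refine (h3 q (hF2Q q hq).1 (hF2Q q hq).2.1 T).trans (le_of_eq ?_)
            ring
        _ = (D * (T + 1)) * ∑ q ∈ F2, (1 : ℝ) / q := by rw [Finset.mul_sum]
        _ ≤ (D * (T + 1)) * (c / (4 * D)) := by
            have := hz1 F2 (fun q hq => ⟨(hF2Q q hq).1, (hF2Q q hq).2.2⟩)
            gcongr
        _ = _ := by field_simp
    linarith
  obtain ⟨T, hT⟩ := exists_nat_gt ((C0 + C1 + c / 4) / (c / 4))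
  rw [div_lt_iff₀ (by positivity)] at hT
  have := key T
  linarith

/-- elements congruent mod q -/
lemma cong_card (S : Finset ℕ) (X : ℝ) (q : ℕ) (hq : 0 < q) (hX : 0 ≤ X)
    (hS : ∀ t ∈ S, (t : ℝ) ≤ X)
    (h : ∀ s ∈ S, ∀ t ∈ S, s ≡ t [MOD q]) : (S.card : ℝ) ≤ X / q + 1 := by
  have hcard : S.card ≤ (Finset.range (⌊X / q⌋₊ + 1)).card := by
    refine Finset.card_le_card_of_injOn (fun t => t / q) ?_ ?_
    · intro t ht
      simp only [Finset.coe_range, Set.mem_Iio]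
      rw [Nat.lt_add_one_iff]
      apply Nat.le_floor
      refine (Nat.cast_div_le).trans ?_
      have := hS t ht
      gcongr
    · intro s hs t ht hst
      have h1 := h s hs t ht
      have h2 : s / q = t / q := hst
      rw [← Nat.div_add_mod s q, ← Nat.div_add_mod t q, h2, h1]
  rw [Finset.card_range] at hcard
  have h2 : (S.card : ℝ) ≤ (⌊X / q⌋₊ : ℝ) + 1 := by exact_mod_cast hcard
  have := Nat.floor_le (show 0 ≤ X / q by positivity)
  linarith

lemma dvd_cong {q u v s t : ℕ} (hq : Nat.Coprime q v) (hs : q ∣ u + v * s) (ht : q ∣ u + v * t) :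
    s ≡ t [MOD q] := by
  have h1 : u + v * s ≡ u + v * t [MOD q] :=
    ((Nat.modEq_zero_iff_dvd).2 hs).trans ((Nat.modEq_zero_iff_dvd).2 ht).symm
  exact Nat.ModEq.cancel_left_of_coprime hq (Nat.ModEq.add_left_cancel' u h1)

lemma ap_count (T u v q : ℕ) (S : Finset ℕ) (hS : ∀ t ∈ S, t < T ∧ q ∣ u + v * t) (hq : 0 < q)
    (hco : Nat.Coprime q v) : (S.card : ℝ) ≤ T / q + 1 := by
  refine cong_card _ _ q hq (by positivity) ?_ ?_
  · intro t ht
    exact_mod_cast (hS t ht).1.le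
  · intro s hs t ht
    exact dvd_cong hco (hS s hs).2 (hS t ht).2

lemma ap_count' (T u v q : ℕ) (hu : 0 < u) (S : Finset ℕ)
    (hS : ∀ t ∈ S, t < T ∧ q ∣ u + v * t) (hq : 0 < q)
    (hco : Nat.Coprime q v) : (S.card : ℝ) ≤ (1 + u + v) * (T + 1) / q := by
  have hq' : (0 : ℝ) < q := by exact_mod_cast hq
  rcases S.eq_empty_or_nonempty with h | ⟨t, ht⟩
  · rw [h]; simp; positivity
  · have h1 := ap_count T u v q S hS hq hco
    have h2 : q ≤ u + v * T := (Nat.le_of_dvd (by omega) (hS t ht).2).trans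
      (by have := (hS t ht).1.le; gcongr)
    have h3 : (q : ℝ) ≤ u + v * T := by exact_mod_cast h2
    refine h1.trans ?_
    rw [div_add_one hq'.ne']
    gcongr
    have : (0 : ℝ) ≤ u := by positivity
    have : (0 : ℝ) ≤ v := by positivity
    have : (0 : ℝ) ≤ T := by positivity
    nlinarith [mul_nonneg (Nat.cast_nonneg (α := ℝ) u) (Nat.cast_nonneg (α := ℝ) T)]

/-- within ε of an integer -/
def NearInt (x ε : ℝ) : Prop := ∃ k : ℤ, |x - k| < ε

lemma near_shift {γ : ℝ} (hγ : Irrational γ) (K : ℕ) (x : ℕ → ℝ) (η : ℝ) (hη : 0 < η) :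
    ∃ (h : ℕ → ℕ) (c : ℝ) (H : ℕ), ∀ i < K, h i ≤ H ∧ NearInt (γ * h i - c - x i) η := by
  have hd : ∀ i, ∃ hz : ℤ, NearInt (γ * hz - x i) η := by
    intro i
    have hden : Dense (AddSubgroup.closure {γ, 1} : Set ℝ) :=
      dense_addSubgroupClosure_pair_iff.2 (by simpa using hγ)
    obtain ⟨y, hy, hxy⟩ := hden.exists_dist_lt (x i) hη
    obtain ⟨a, b, hab⟩ := AddSubgroup.mem_closure_pair.1 hy
    refine ⟨a, -b, ?_⟩
    rw [Real.dist_eq, abs_sub_comm, ← hab] at hxy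
    convert hxy using 2
    simp
    ring
  choose hz hhz using hd
  set N : ℕ := ∑ i ∈ Finset.range K, (hz i).natAbs with hN
  refine ⟨fun i => (hz i + N).toNat, γ * N, 2 * N, ?_⟩
  intro i hi
  have hle : (hz i).natAbs ≤ N :=
    Finset.single_le_sum (f := fun i => (hz i).natAbs) (fun _ _ => Nat.zero_le _)
      (Finset.mem_range.2 hi)
  refine ⟨by show (hz i + N).toNat ≤ 2 * N; omega, ?_⟩
  have h1 : (((hz i + N).toNat : ℤ)) = hz i + N := Int.toNat_of_nonneg (by omega)
  have h2 : (((hz i + N).toNat : ℕ) : ℝ) = hz i + N := by exact_mod_cast h1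
  rw [h2]
  convert hhz i using 1
  ring

open Classical in
lemma near_upper {γ : ℝ} (hγ : Irrational γ) (β ε : ℝ) (hε : 0 < ε) (hε' : ε ≤ 1 / 4) :
    ∃ C : ℝ, ∀ T : ℕ, (((Finset.range T).filter (fun s : ℕ => NearInt (γ * s + β) ε)).card : ℝ)
      ≤ 8 * ε * T + C := by
  set K := ⌊1 / (4 * ε)⌋₊ with hK
  have hK1 : (K : ℝ) ≤ 1 / (4 * ε) := Nat.floor_le (by positivity)
  have hK2 : 1 / (4 * ε) < K + 1 := Nat.lt_floor_add_one _
  have hK0 : 1 ≤ K := by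
    apply Nat.le_floor
    rw [le_div_iff₀ (by positivity)]
    push_cast; linarith
  have hK0' : (1 : ℝ) ≤ K := by exact_mod_cast hK0
  rw [le_div_iff₀ (by positivity)] at hK1
  rw [div_lt_iff₀ (by positivity)] at hK2
  obtain ⟨h, c, H, hh⟩ := near_shift hγ K (fun i => 4 * ε * i) ε hε
  refine ⟨8 * ε * H, fun T => ?_⟩
  set S := (Finset.range T).filter (fun s : ℕ => NearInt (γ * s + β) ε) with hS
  have hcard : ((Finset.range K) ×ˢ S).card ≤ (Finset.range (T + H)).card := by
    refine Finset.card_le_card_of_injOn (fun p => p.2 + h p.1) ?_ ?_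
    · rintro ⟨i, s⟩ hp
      simp only [Finset.coe_product, Set.mem_prod, Finset.mem_coe, Finset.mem_range, hS,
        Finset.mem_filter] at hp
      have := (hh i hp.1).1
      simp only [Finset.coe_range, Set.mem_Iio]
      omega
    · rintro ⟨i, s⟩ hp ⟨j, t⟩ hp' hst
      simp only [Finset.coe_product, Set.mem_prod, Finset.mem_coe, Finset.mem_range, hS,
        Finset.mem_filter] at hp hp' hst
      obtain ⟨hi, hs, k1, hk1⟩ := hp
      obtain ⟨hj, ht, k2, hk2⟩ := hp'
      obtain ⟨_, k3, hk3⟩ := hh i hi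
      obtain ⟨_, k4, hk4⟩ := hh j hj
      have hstR : (s : ℝ) + h i = t + h j := by exact_mod_cast hst
      have hij : i = j := by
        have heq : γ * s + γ * h i = γ * t + γ * h j := by rw [← mul_add, ← mul_add, hstR]
        rw [abs_lt] at hk1 hk2 hk3 hk4
        set n : ℤ := k2 + k4 - k1 - k3 with hn
        have hnR : (n : ℝ) = k2 + k4 - k1 - k3 := by rw [hn]; push_cast; ring
        have b1 : 4 * ε * (i - j) - n < 4 * ε := by rw [hnR]; linarith
        have b2 : -(4 * ε) < 4 * ε * (i - j) - n := by rw [hnR]; linarith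
        have hiK : (i : ℝ) + 1 ≤ K := by exact_mod_cast hi
        have hjK : (j : ℝ) + 1 ≤ K := by exact_mod_cast hj
        have hi0 : (0 : ℝ) ≤ i := by positivity
        have hj0 : (0 : ℝ) ≤ j := by positivity
        have n1 : (n : ℝ) < 1 := by nlinarith
        have n2 : (-1 : ℝ) < n := by nlinarith
        have n0 : n = 0 := by
          have h1 : n < 1 := by exact_mod_cast n1
          have h2 : -1 < n := by exact_mod_cast n2
          omega
        rw [n0] at b1 b2
        have c1 : (i : ℝ) - j < 1 := by
          by_contra hc
          push Not at hc
          push_cast at b1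
          nlinarith
        have c2 : (j : ℝ) - i < 1 := by
          by_contra hc
          push Not at hc
          push_cast at b2
          nlinarith
        have d1 : i < j + 1 := by
          have : (i : ℝ) < j + 1 := by linarith
          exact_mod_cast this
        have d2 : j < i + 1 := by
          have : (j : ℝ) < i + 1 := by linarith
          exact_mod_cast this
        omega
      subst hij
      have : s = t := by omega
      rw [this]
  rw [Finset.card_product, Finset.card_range, Finset.card_range] at hcard
  have hcR : (K : ℝ) * S.card ≤ T + H := by exact_mod_cast hcard
  have hS0 : (0 : ℝ) ≤ S.card := by positivity
  have : 1 ≤ 8 * ε * K := by nlinarith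
  calc (S.card : ℝ) ≤ (8 * ε * K) * S.card := by nlinarith
    _ = 8 * ε * (K * S.card) := by ring
    _ ≤ 8 * ε * (T + H) := by gcongr
    _ = _ := by ring

open Classical in
lemma near_lower {γ : ℝ} (hγ : Irrational γ) (β ε : ℝ) (hε : 0 < ε) (hε' : ε ≤ 1 / 4) :
    ∃ C : ℝ, ∀ T : ℕ, ε / 4 * T - C ≤
      (((Finset.range T).filter (fun s : ℕ => NearInt (γ * s + β) ε)).card : ℝ) := by
  set K := ⌈2 / ε⌉₊ with hK
  have hK1 : 2 / ε ≤ K := Nat.le_ceil _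
  have hK2 : (K : ℝ) < 2 / ε + 1 := Nat.ceil_lt_add_one (by positivity)
  have hKpos : (0 : ℝ) < K := lt_of_lt_of_le (by positivity) hK1
  have hK0 : 0 < K := by exact_mod_cast hKpos
  have hK3 : (K : ℝ) * ε ≤ 4 := by
    have := mul_le_mul_of_nonneg_right hK2.le hε.le
    have h2 : (2 / ε + 1) * ε = 2 + ε := by field_simp
    linarith
  have hK4 : 1 / (K : ℝ) ≤ ε / 2 := by
    rw [div_le_iff₀ hε] at hK1
    rw [div_le_iff₀ hKpos]; linarith
  obtain ⟨h, c, H, hh⟩ := near_shift hγ K (fun i => (i : ℝ) / K) (ε / 2) (by positivity)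
  refine ⟨H, fun T => ?_⟩
  set S := (Finset.range T).filter (fun s : ℕ => NearInt (γ * s + β) ε) with hS
  have hsel : ∀ s : ℕ, ∃ i < K, NearInt (γ * (s + h i : ℕ) + β) ε := by
    intro s
    set y := γ * s + β + c with hy
    set j := ⌊-y * K⌋ with hj
    have j1 : (j : ℝ) ≤ -y * K := Int.floor_le _
    have j2 : -y * K < j + 1 := Int.lt_floor_add_one _
    have hKz : (0 : ℤ) < K := by exact_mod_cast hK0
    have hm0 := Int.emod_nonneg j hKz.ne'
    have hm1 := Int.emod_lt_of_pos j hKz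
    have hdm := Int.emod_add_mul_ediv j K
    obtain ⟨i, hi⟩ := Int.eq_ofNat_of_zero_le hm0
    have hiK : i < K := by omega
    obtain ⟨_, k, hk⟩ := hh i hiK
    refine ⟨i, hiK, k - j / K, ?_⟩
    have hjR : (j : ℝ) = i + K * ((j / K : ℤ) : ℝ) := by
      rw [hi] at hdm; exact_mod_cast hdm.symm
    have e1 : y + (i : ℝ) / K + ((j / K : ℤ) : ℝ) ≤ 0 := by
      have : y + (i : ℝ) / K + ((j / K : ℤ) : ℝ) = (y * K + j) / K := by
        rw [hjR]; field_simp; ring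
      rw [this]
      apply div_nonpos_of_nonpos_of_nonneg _ hKpos.le
      linarith
    have e2 : -(1 / (K : ℝ)) ≤ y + (i : ℝ) / K + ((j / K : ℤ) : ℝ) := by
      have : y + (i : ℝ) / K + ((j / K : ℤ) : ℝ) = (y * K + j) / K := by
        rw [hjR]; field_simp; ring
      rw [this, ← neg_div]
      gcongr
      linarith
    rw [abs_lt] at hk ⊢
    push_cast
    constructor <;> nlinarith
  choose f hf using hsel
  have hcard : (Finset.range T).card ≤
      ((Finset.range K) ×ˢ (S ∪ Finset.Ico T (T + H))).card := by
    refine Finset.card_le_card_of_injOn (fun s => (f s, s + h (f s))) ?_ ?_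
    · intro s hs
      simp only [Finset.coe_range, Set.mem_Iio] at hs
      have h1 := (hh (f s) (hf s).1).1
      simp only [Finset.coe_product, Set.mem_prod, Finset.mem_coe, Finset.mem_range,
        Finset.mem_union, Finset.mem_Ico, hS, Finset.mem_filter]
      refine ⟨(hf s).1, ?_⟩
      by_cases hT : s + h (f s) < T
      · left; exact ⟨hT, (hf s).2⟩
      · right; omega
    · intro s hs t ht hst
      simp only [Prod.mk.injEq] at hst
      obtain ⟨h1, h2⟩ := hst
      rw [h1] at h2
      omega
  rw [Finset.card_product, Finset.card_range, Finset.card_range] at hcard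
  have h5 : (S ∪ Finset.Ico T (T + H)).card ≤ S.card + H := by
    refine (Finset.card_union_le _ _).trans ?_
    simp
  have h6 : T ≤ K * (S.card + H) := hcard.trans (Nat.mul_le_mul_left _ h5)
  have h7 : (T : ℝ) ≤ K * (S.card + H) := by exact_mod_cast h6
  have h8 : ε / 4 * T ≤ ε / 4 * (K * (S.card + H)) := by gcongr
  have h9 : (0 : ℝ) ≤ (S.card : ℝ) + H := by positivity
  nlinarith

lemma mem_closure_of_primes (P : Set ℕ) (α : ℝ) (n : ℕ) (hn : n ≠ 0)
    (h : ∀ q : ℕ, (q.Prime ∧ q ∉ P) → ¬ q ∣ n) :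
    (n : ℝ) ∈ Submonoid.closure ((((↑) : ℕ → ℝ) '' P) ∪ {α}) := by
  have h1 : (n : ℝ) = (n.primeFactorsList.map ((↑) : ℕ → ℝ)).prod := by
    conv_lhs => rw [← Nat.prod_primeFactorsList hn]
    exact Nat.cast_list_prod _
  rw [h1]
  apply Submonoid.list_prod_mem
  intro x hx
  obtain ⟨p, hp, rfl⟩ := List.mem_map.1 hx
  apply Submonoid.subset_closure
  left
  refine ⟨p, ?_, rfl⟩
  by_contra hpP
  exact h p ⟨Nat.prime_of_mem_primeFactorsList hp, hpP⟩ (Nat.dvd_of_mem_primeFactorsList hp)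

lemma tail_of_summable (P : Set ℕ)
    (hsum : Summable (fun p : {p : ℕ // p.Prime ∧ p ∉ P} => (1 : ℝ) / ((p : ℕ) : ℝ))) :
    ∀ η > (0 : ℝ), ∃ z : ℕ, ∀ F : Finset ℕ, (∀ q ∈ F, q ∈ {p : ℕ | p.Prime ∧ p ∉ P} ∧ z < q) →
      ∑ q ∈ F, (1 : ℝ) / q ≤ η := by
  intro η hη
  have h1 : Summable (Set.indicator {p : ℕ | p.Prime ∧ p ∉ P} (fun p : ℕ => (1 : ℝ) / p)) :=
    summable_subtype_iff_indicator.1 hsum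
  obtain ⟨s, hs⟩ := summable_iff_vanishing_norm.1 h1 η hη
  refine ⟨s.sup id, fun F hF => ?_⟩
  have h2 := hs F (by
    rw [Finset.disjoint_left]
    intro q hq hqs
    have : q ≤ s.sup id := Finset.le_sup (f := id) hqs
    have := (hF q hq).2
    omega)
  have h3 : ∑ q ∈ F, Set.indicator {p : ℕ | p.Prime ∧ p ∉ P} (fun p : ℕ => (1 : ℝ) / p) q =
      ∑ q ∈ F, (1 : ℝ) / q := by
    refine Finset.sum_congr rfl (fun q hq => ?_)
    rw [Set.indicator_of_mem (hF q hq).1]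
  rw [h3] at h2
  exact (le_abs_self _).trans h2.le

lemma small_prime_not_dvd {q z : ℕ} (hq : q.Prime) (hqz : q ≤ z) (r : ℕ) :
    ¬ q ∣ 1 + z.factorial * r := by
  intro h
  have h1 : q ∣ z.factorial * r := Dvd.dvd.mul_right ((hq.dvd_factorial).2 hqz) r
  exact hq.one_lt.ne' (Nat.dvd_one.1 ((Nat.dvd_add_left h1).1 h))

lemma big_prime_coprime {q z : ℕ} (hq : q.Prime) (hqz : z < q) :
    Nat.Coprime q z.factorial := by
  rw [hq.coprime_iff_not_dvd, hq.dvd_factorial]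
  omega

open Classical in
lemma rational_case (P : Set ℕ)
    (hsum : Summable (fun p : {p : ℕ // p.Prime ∧ p ∉ P} => (1 : ℝ) / ((p : ℕ) : ℝ)))
    (a b : ℕ) (ha : 0 < a) (hb : 1 < b) (hab : Nat.Coprime a b) (δ : ℝ) (hδ : 0 < δ) :
    ∃ m n k : ℕ, m ≠ 0 ∧ n ≠ 0 ∧ (∀ q : ℕ, (q.Prime ∧ q ∉ P) → ¬ q ∣ m) ∧
      (∀ q : ℕ, (q.Prime ∧ q ∉ P) → ¬ q ∣ n) ∧ (m : ℝ) ≠ ((a : ℝ) / b) ^ k * n ∧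
      |(m : ℝ) - ((a : ℝ) / b) ^ k * n| < δ := by
  have htail := tail_of_summable P hsum
  obtain ⟨z', hz'⟩ := htail (1 / 4) (by norm_num)
  set z := z' + a + b with hz
  set W := z.factorial with hW
  have hWpos : 0 < W := Nat.factorial_pos _
  obtain ⟨k, hk⟩ := pow_unbounded_of_one_lt ((W : ℝ) / δ) (show (1 : ℝ) < b by exact_mod_cast hb)
  rw [div_lt_iff₀ hδ] at hk
  set u := b ^ k with hu
  set v := a ^ k with hv
  have hupos : 0 < u := by positivity
  have hvpos : 0 < v := by positivity
  have huv : Nat.Coprime u v := Nat.Coprime.pow k k hab.symm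
  -- Bezout
  obtain ⟨r0, s0, c, hc0, hcW, hc⟩ : ∃ r0 s0 : ℕ, ∃ c : ℤ, 0 < c ∧ c ≤ W ∧
      (u : ℤ) * (1 + W * r0) - v * (1 + W * s0) = c := by
    have hWz : (0 : ℤ) < W := by exact_mod_cast hWpos
    set e : ℤ := -(((u : ℤ) - v - 1) / W) with he
    have hdm := Int.emod_add_mul_ediv ((u : ℤ) - v - 1) W
    have hbz : (u : ℤ) * Nat.gcdA u v + v * Nat.gcdB u v = 1 := by
      have := Nat.gcd_eq_gcd_ab u v
      rw [huv.gcd_eq_one] at this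
      exact_mod_cast this.symm
    set x := Nat.gcdA u v * e with hx
    set y := -(Nat.gcdB u v) * e with hy
    have hxy : (u : ℤ) * x - v * y = e := by
      rw [hx, hy]; linear_combination e * hbz
    set N : ℤ := |x| + |y| with hN
    have hu1 : (1 : ℤ) ≤ u := by exact_mod_cast hupos
    have hv1 : (1 : ℤ) ≤ v := by exact_mod_cast hvpos
    have hN0 : 0 ≤ N := by positivity
    have hr : 0 ≤ x + v * N := by nlinarith [neg_abs_le x, abs_nonneg y]
    have hs : 0 ≤ y + u * N := by nlinarith [neg_abs_le y, abs_nonneg x]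
    obtain ⟨r0, hr0⟩ := Int.eq_ofNat_of_zero_le hr
    obtain ⟨s0, hs0⟩ := Int.eq_ofNat_of_zero_le hs
    refine ⟨r0, s0, ((u : ℤ) - v - 1) % W + 1, ?_, ?_, ?_⟩
    · have := Int.emod_nonneg ((u : ℤ) - v - 1) hWz.ne'
      omega
    · have := Int.emod_lt_of_pos ((u : ℤ) - v - 1) hWz
      omega
    · rw [← hr0, ← hs0]
      have : (u : ℤ) * (1 + W * (x + v * N)) - v * (1 + W * (y + u * N)) =
        u - v + W * (u * x - v * y) := by ring
      rw [this, hxy, he]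
      linarith
  set Q : Set ℕ := {p : ℕ | p.Prime ∧ p ∉ P} with hQ
  have hcop : ∀ q ∈ Q, z < q → Nat.Coprime q (W * v) ∧ Nat.Coprime q (W * u) := by
    intro q hq hzq
    have h1 := big_prime_coprime hq.1 hzq
    have h2 : Nat.Coprime q v := Nat.Coprime.pow_right _
      (Nat.coprime_of_lt_prime ha.ne' (by omega) hq.1)
    have h3 : Nat.Coprime q u := Nat.Coprime.pow_right _
      (Nat.coprime_of_lt_prime (by omega) (by omega) hq.1)
    exact ⟨Nat.Coprime.mul_right h1 h2, Nat.Coprime.mul_right h1 h3⟩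
  have hsplit : ∀ q T : ℕ, ((((Finset.range T).filter (fun t => t ∈ (Set.univ : Set ℕ) ∧
      (q ∣ (1 + W * r0) + (W * v) * t ∨ q ∣ (1 + W * s0) + (W * u) * t))).card : ℕ) : ℝ) ≤
      (((Finset.range T).filter (fun t => q ∣ (1 + W * r0) + (W * v) * t)).card : ℝ) +
      (((Finset.range T).filter (fun t => q ∣ (1 + W * s0) + (W * u) * t)).card : ℝ) := by
    intro q T
    rw [← Nat.cast_add]
    refine Nat.cast_le.2 (le_trans (Finset.card_le_card ?_) (Finset.card_union_le _ _))
    intro t ht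
    simp only [Finset.mem_filter, Finset.mem_union, Finset.mem_range] at ht ⊢
    tauto
  have hmem : ∀ (q T u v : ℕ), ∀ t ∈ (Finset.range T).filter (fun t => q ∣ u + v * t),
      t < T ∧ q ∣ u + v * t := by
    intro q T u v t ht
    simpa using ht
  obtain ⟨t, -, ht⟩ := sieve_aux Q htail Set.univ
    (fun q t => q ∣ (1 + W * r0) + (W * v) * t ∨ q ∣ (1 + W * s0) + (W * u) * t) z 1 0
    ((1 + (1 + W * r0 : ℕ) + (W * v : ℕ)) + (1 + (1 + W * s0 : ℕ) + (W * u : ℕ))) 2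
    one_pos (by positivity) (by intro T; simp)
    (by
      intro q hq hqz t _ h
      rcases h with h | h
      · exact small_prime_not_dvd hq.1 hqz (r0 + v * t) (by convert h using 1; ring)
      · exact small_prime_not_dvd hq.1 hqz (s0 + u * t) (by convert h using 1; ring))
    (by
      intro q hq hzq
      refine ⟨2, fun T => le_trans (le_of_eq ?_) ((hsplit q T).trans ?_)⟩
      · congr!
      have h1 := ap_count T _ _ q _ (hmem q T (1 + W * r0) (W * v)) hq.1.pos (hcop q hq hzq).1
      have h2 := ap_count T _ _ q _ (hmem q T (1 + W * s0) (W * u)) hq.1.pos (hcop q hq hzq).2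
      have h3 : (2 : ℝ) / q * T = T / q + T / q := by ring
      linarith)
    (by
      intro q hq hzq T
      refine le_trans (le_of_eq ?_) ((hsplit q T).trans ?_)
      · congr!
      have h1 := ap_count' T _ _ q (by omega) _ (hmem q T (1 + W * r0) (W * v)) hq.1.pos
        (hcop q hq hzq).1
      have h2 := ap_count' T _ _ q (by omega) _ (hmem q T (1 + W * s0) (W * u)) hq.1.pos
        (hcop q hq hzq).2
      rw [add_mul, add_div]
      linarith)
    (by
      intro F hF
      have h1 := hz' F (fun q hq => ⟨(hF q hq).1, by have := (hF q hq).2; omega⟩)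
      have h2 : ∑ q ∈ F, (2 : ℝ) / q = 2 * ∑ q ∈ F, (1 : ℝ) / q := by
        rw [Finset.mul_sum]
        exact Finset.sum_congr rfl (fun q _ => by ring)
      rw [h2]; linarith)
  have hcR : (u : ℝ) * (1 + W * r0) - v * (1 + W * s0) = c := by exact_mod_cast hc
  have huR : (0 : ℝ) < u := by exact_mod_cast hupos
  have hdiff : (((1 + W * r0) + (W * v) * t : ℕ) : ℝ) -
      ((a : ℝ) / b) ^ k * (((1 + W * s0) + (W * u) * t : ℕ) : ℝ) = c / u := by
    have : ((a : ℝ) / b) ^ k = v / u := by rw [div_pow, hu, hv]; push_cast; rfl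
    rw [this, ← hcR]
    push_cast
    field_simp
    ring
  have hc0R : (0 : ℝ) < c := by exact_mod_cast hc0
  have hcWR : (c : ℝ) ≤ W := by exact_mod_cast hcW
  have hpos : (0 : ℝ) < c / u := by positivity
  refine ⟨(1 + W * r0) + (W * v) * t, (1 + W * s0) + (W * u) * t, k, by omega, by omega,
    fun q hq h => ht q hq (Or.inl h), fun q hq h => ht q hq (Or.inr h), ?_, ?_⟩
  · intro h
    rw [← sub_eq_zero, hdiff] at h
    linarith
  · rw [hdiff, abs_of_pos hpos, div_lt_iff₀ huR]
    have : (u : ℝ) = (b : ℝ) ^ k := by rw [hu]; push_cast; rfl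
    rw [this]; linarith

open Classical in
lemma irrational_case (P : Set ℕ)
    (hsum : Summable (fun p : {p : ℕ // p.Prime ∧ p ∉ P} => (1 : ℝ) / ((p : ℕ) : ℝ)))
    (α : ℝ) (hα : 1 < α) (hirr : Irrational α) (δ : ℝ) (hδ : 0 < δ) :
    ∃ m n : ℕ, m ≠ 0 ∧ n ≠ 0 ∧ (∀ q : ℕ, (q.Prime ∧ q ∉ P) → ¬ q ∣ m) ∧
      (∀ q : ℕ, (q.Prime ∧ q ∉ P) → ¬ q ∣ n) ∧ |(m : ℝ) - α * n| < δ := by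
  have htail := tail_of_summable P hsum
  obtain ⟨z, hz⟩ := htail (1 / 128) (by norm_num)
  set W := z.factorial with hW
  have hWpos : 0 < W := Nat.factorial_pos _
  have hWR : (0 : ℝ) < W := by exact_mod_cast hWpos
  have hW1 : (1 : ℝ) ≤ W := by exact_mod_cast hWpos
  set Q : Set ℕ := {p : ℕ | p.Prime ∧ p ∉ P} with hQ
  set ε : ℝ := min (δ / W) (1 / 4) with hεdef
  have hε : 0 < ε := by positivity
  have hε4 : ε ≤ 1 / 4 := min_le_right _ _
  have hεδ : ε * W ≤ δ := by
    have := min_le_left (δ / W) (1 / 4 : ℝ)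
    rwa [le_div_iff₀ hWR] at this
  set β : ℝ := (α - 1) / W with hβ
  have hβ0 : 0 < β := div_pos (by linarith) hWR
  have hβα : β ≤ α := by
    rw [hβ, div_le_iff₀ hWR]; nlinarith
  have hr : ∀ s : ℕ, ∃ r : ℕ, NearInt (α * s + β) ε → |α * s + β - r| < ε := by
    intro s
    by_cases h : NearInt (α * s + β) ε
    · obtain ⟨k, hk⟩ := h
      have h0 : 0 ≤ k := by
        have h1 : (-1 : ℝ) < k := by
          have := (abs_lt.1 hk).2
          have : 0 ≤ α * s := by positivity
          linarith
        have h2 : (-1 : ℤ) < k := by exact_mod_cast h1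
        omega
      obtain ⟨r, hr⟩ := Int.eq_ofNat_of_zero_le h0
      refine ⟨r, fun _ => ?_⟩
      rw [hr] at hk
      exact_mod_cast hk
    · exact ⟨0, fun h' => absurd h' h⟩
  choose r hr using hr
  set A : Set ℕ := {s | NearInt (α * s + β) ε} with hA
  have hrA : ∀ s ∈ A, |α * s + β - r s| < ε := fun s hs => hr s hs
  have hsplit : ∀ q T : ℕ, ((((Finset.range T).filter (fun t => t ∈ A ∧
      (q ∣ 1 + W * t ∨ q ∣ 1 + W * r t))).card : ℕ) : ℝ) ≤
      (((Finset.range T).filter (fun t => t ∈ A ∧ q ∣ 1 + W * t)).card : ℝ) +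
      (((Finset.range T).filter (fun t => t ∈ A ∧ q ∣ 1 + W * r t)).card : ℝ) := by
    intro q T
    rw [← Nat.cast_add]
    refine Nat.cast_le.2 (le_trans (Finset.card_le_card ?_) (Finset.card_union_le _ _))
    intro t ht
    simp only [Finset.mem_filter, Finset.mem_union, Finset.mem_range] at ht ⊢
    tauto
  obtain ⟨C0, hC0⟩ := near_lower hirr β ε hε hε4
  have hfine1 : ∀ q ∈ Q, z < q → ∃ C : ℝ, ∀ T : ℕ,
      (((Finset.range T).filter (fun t => t ∈ A ∧ q ∣ 1 + W * t)).card : ℝ) ≤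
        8 * ε / q * T + C := by
    intro q hq hzq
    have hq0 : 0 < q := hq.1.pos
    have hqR : (0 : ℝ) < q := by exact_mod_cast hq0
    have hco := big_prime_coprime hq.1 hzq
    by_cases hex : ∃ s0, q ∣ 1 + W * s0
    · obtain ⟨s0, hs0⟩ := hex
      obtain ⟨C, hC⟩ := near_upper (γ := α * q) (hirr.mul_natCast hq0.ne')
        (α * (s0 % q : ℕ) + β) ε hε hε4
      refine ⟨8 * ε + C, fun T => ?_⟩
      have hle : ((Finset.range T).filter (fun t => t ∈ A ∧ q ∣ 1 + W * t)).card ≤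
          ((Finset.range (T / q + 1)).filter (fun s : ℕ =>
            NearInt (α * q * s + (α * (s0 % q : ℕ) + β)) ε)).card := by
        refine Finset.card_le_card_of_injOn (fun s => s / q) ?_ ?_
        · intro s hs
          simp only [Finset.coe_filter, Finset.mem_range, Set.mem_ofPred_eq] at hs ⊢
          refine ⟨Nat.lt_add_one_iff.2 (Nat.div_le_div_right hs.1.le), ?_⟩
          have h1 : s % q = s0 % q := dvd_cong hco hs.2.2 hs0
          have h2 := Nat.div_add_mod s q
          have h3 : (s : ℝ) = q * (s / q : ℕ) + (s0 % q : ℕ) := by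
            rw [← h1]; exact_mod_cast h2.symm
          have h4 : NearInt (α * s + β) ε := hs.2.1
          rw [h3] at h4
          convert h4 using 1
          ring
        · intro s hs t ht hst
          simp only [Finset.coe_filter, Finset.mem_range, Set.mem_ofPred_eq] at hs ht
          have h1 : s % q = t % q := dvd_cong hco hs.2.2 ht.2.2
          have h2 : s / q = t / q := hst
          rw [← Nat.div_add_mod s q, ← Nat.div_add_mod t q, h1, h2]
      refine (Nat.cast_le.2 hle).trans ((hC (T / q + 1)).trans ?_)
      have h5 : ((T / q : ℕ) : ℝ) ≤ T / q := Nat.cast_div_le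
      have h6 : 8 * ε / q * T = 8 * ε * (T / q) := by ring
      rw [h6]
      push_cast
      nlinarith
    · refine ⟨0, fun T => ?_⟩
      push Not at hex
      have : (Finset.range T).filter (fun t => t ∈ A ∧ q ∣ 1 + W * t) = ∅ := by
        apply Finset.filter_eq_empty_iff.2
        intro t _ h
        exact hex t h.2
      rw [this]
      simp
      positivity
  have hfine2 : ∀ q ∈ Q, z < q → ∃ C : ℝ, ∀ T : ℕ,
      (((Finset.range T).filter (fun t => t ∈ A ∧ q ∣ 1 + W * r t)).card : ℝ) ≤
        8 * ε / q * T + C := by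
    intro q hq hzq
    have hq0 : 0 < q := hq.1.pos
    have hqR : (0 : ℝ) < q := by exact_mod_cast hq0
    have hq1 : (1 : ℝ) ≤ q := by exact_mod_cast hq0
    have hco := big_prime_coprime hq.1 hzq
    by_cases hex : ∃ s0, q ∣ 1 + W * s0
    · obtain ⟨s0, hs0⟩ := hex
      obtain ⟨C, hC⟩ := near_upper (γ := α / q) (hirr.div_natCast hq0.ne')
        ((β - (s0 % q : ℕ)) / q) (ε / q) (by positivity) ((div_le_self hε.le hq1).trans hε4)
      refine ⟨C, fun T => ?_⟩
      have hle : ((Finset.range T).filter (fun t => t ∈ A ∧ q ∣ 1 + W * r t)).card ≤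
          ((Finset.range T).filter (fun s : ℕ =>
            NearInt (α / q * s + (β - (s0 % q : ℕ)) / q) (ε / q))).card := by
        refine Finset.card_le_card ?_
        intro s hs
        simp only [Finset.mem_filter, Finset.mem_range] at hs ⊢
        refine ⟨hs.1, ((r s / q : ℕ) : ℤ), ?_⟩
        have h1 : r s % q = s0 % q := dvd_cong hco hs.2.2 hs0
        have h2 := Nat.div_add_mod (r s) q
        have h3 : (r s : ℝ) = q * (r s / q : ℕ) + (s0 % q : ℕ) := by
          rw [← h1]; exact_mod_cast h2.symm
        have h4 := hrA s hs.2.1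
        rw [h3] at h4
        have h5 : α / q * s + (β - (s0 % q : ℕ)) / q - (((r s / q : ℕ) : ℤ) : ℝ) =
            (α * s + β - (q * (r s / q : ℕ) + (s0 % q : ℕ))) / q := by
          rw [Int.cast_natCast]
          field_simp
          ring
        rw [h5, abs_div, abs_of_pos hqR]
        gcongr
      refine (Nat.cast_le.2 hle).trans ((hC T).trans (le_of_eq ?_))
      ring
    · refine ⟨0, fun T => ?_⟩
      push Not at hex
      have : (Finset.range T).filter (fun t => t ∈ A ∧ q ∣ 1 + W * r t) = ∅ := by
        apply Finset.filter_eq_empty_iff.2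
        intro t _ h
        exact hex _ h.2
      rw [this]
      simp
      positivity
  have hcoarse2 : ∀ q ∈ Q, z < q → ∀ T : ℕ,
      (((Finset.range T).filter (fun t => t ∈ A ∧ q ∣ 1 + W * r t)).card : ℝ) ≤
        ((α + 1) + (1 + W * (α + 1))) * (T + 1) / q := by
    intro q hq hzq T
    have hq0 : 0 < q := hq.1.pos
    have hqR : (0 : ℝ) < q := by exact_mod_cast hq0
    have hco := big_prime_coprime hq.1 hzq
    set S := (Finset.range T).filter (fun t => t ∈ A ∧ q ∣ 1 + W * r t) with hS
    have hSm : ∀ s ∈ S, s < T ∧ s ∈ A ∧ q ∣ 1 + W * r s := by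
      intro s hs
      simpa [hS] using hs
    have hbd : ∀ s ∈ S, (r s : ℝ) ≤ (α + 1) * (T + 1) := by
      intro s hs
      obtain ⟨h1, h2, -⟩ := hSm s hs
      have h3 := (abs_lt.1 (hrA s h2)).1
      have h4 : (s : ℝ) ≤ T := by exact_mod_cast h1.le
      have h5 : (0 : ℝ) ≤ T := by positivity
      nlinarith
    have hinj : Set.InjOn r S := by
      intro s hs t ht hst
      have h1 := abs_lt.1 (hrA s (hSm s hs).2.1)
      have h2 := abs_lt.1 (hrA t (hSm t ht).2.1)
      rw [hst] at h1
      have c1 : (s : ℝ) < t + 1 := by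
        by_contra hc
        push Not at hc
        nlinarith
      have c2 : (t : ℝ) < s + 1 := by
        by_contra hc
        push Not at hc
        nlinarith
      have d1 : s < t + 1 := by exact_mod_cast c1
      have d2 : t < s + 1 := by exact_mod_cast c2
      omega
    rcases S.eq_empty_or_nonempty with h | ⟨s, hs⟩
    · rw [h]; simp; positivity
    · have h1 : ((S.image r).card : ℝ) ≤ (α + 1) * (T + 1) / q + 1 := by
        refine cong_card _ _ q hq0 (by positivity) ?_ ?_
        · intro t ht
          obtain ⟨s, hs, rfl⟩ := Finset.mem_image.1 ht
          exact hbd s hs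
        · intro t ht t' ht'
          obtain ⟨s, hs, rfl⟩ := Finset.mem_image.1 ht
          obtain ⟨s', hs', rfl⟩ := Finset.mem_image.1 ht'
          exact dvd_cong hco (hSm s hs).2.2 (hSm s' hs').2.2
      rw [Finset.card_image_of_injOn hinj] at h1
      have h2 : q ≤ 1 + W * r s := Nat.le_of_dvd (by omega) (hSm s hs).2.2
      have h3 : (q : ℝ) ≤ 1 + W * r s := by exact_mod_cast h2
      have h4 : (W : ℝ) * r s ≤ W * ((α + 1) * (T + 1)) := by
        have := hbd s hs
        gcongr
      refine h1.trans ?_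
      rw [div_add_one hqR.ne']
      gcongr
      have h5 : (0 : ℝ) ≤ T := by positivity
      nlinarith
  obtain ⟨s, hsA, hs⟩ := sieve_aux Q htail A
    (fun q t => q ∣ 1 + W * t ∨ q ∣ 1 + W * r t) z (ε / 4) C0
    ((1 + (1 : ℕ) + W) + ((α + 1) + (1 + W * (α + 1)))) (16 * ε)
    (by positivity) (by positivity) (by intro T; exact hC0 T)
    (by
      intro q hq hqz t _ h
      rcases h with h | h
      · exact small_prime_not_dvd hq.1 hqz _ h
      · exact small_prime_not_dvd hq.1 hqz _ h)
    (by
      intro q hq hzq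
      obtain ⟨C1, h1⟩ := hfine1 q hq hzq
      obtain ⟨C2, h2⟩ := hfine2 q hq hzq
      refine ⟨C1 + C2, fun T => le_trans (le_of_eq ?_) ((hsplit q T).trans ?_)⟩
      · congr!
      have h3 : 16 * ε / q * T = 8 * ε / q * T + 8 * ε / q * T := by ring
      linarith [h1 T, h2 T])
    (by
      intro q hq hzq T
      refine le_trans (le_of_eq ?_) ((hsplit q T).trans ?_)
      · congr!
      have h1 := ap_count' T 1 W q one_pos
        ((Finset.range T).filter (fun t => t ∈ A ∧ q ∣ 1 + W * t))
        (by
          intro t ht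
          simp only [Finset.mem_filter, Finset.mem_range] at ht
          exact ⟨ht.1, ht.2.2⟩) hq.1.pos (big_prime_coprime hq.1 hzq)
      have h2 := hcoarse2 q hq hzq T
      rw [add_mul, add_div]
      linarith)
    (by
      intro F hF
      have h1 := hz F hF
      have h2 : ∑ q ∈ F, (16 * ε) / q = 16 * ε * ∑ q ∈ F, (1 : ℝ) / q := by
        rw [Finset.mul_sum]
        exact Finset.sum_congr rfl (fun q _ => by ring)
      rw [h2]; nlinarith)
  refine ⟨1 + W * r s, 1 + W * s, by omega, by omega,
    fun q hq h => hs q hq (Or.inr h), fun q hq h => hs q hq (Or.inl h), ?_⟩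
  have h1 : ((1 + W * r s : ℕ) : ℝ) - α * ((1 + W * s : ℕ) : ℝ) = -(W * (α * s + β - r s)) := by
    have : (W : ℝ) * β = α - 1 := by rw [hβ]; field_simp
    push_cast
    linear_combination this
  rw [h1, abs_neg, abs_mul, abs_of_pos hWR]
  have := hrA s hsA
  nlinarith

/-- **Theorem 1 (Ruzsa, "Beurling-integers with lacunarity").**
If `P` is a set of primes with `∑_{p ∉ P} 1/p < ∞` and `α > 1` is a non-integer real,
then the multiplicative semigroup generated by `P ∪ {α}` has `liminf (b_{i+1} - b_i) = 0`:
for every `δ > 0` there are distinct elements at distance `< δ`. -/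
theorem stmt_0 (P : Set ℕ) (hP : ∀ p ∈ P, p.Prime)
    (hsum : Summable (fun p : {p : ℕ // p.Prime ∧ p ∉ P} => (1 : ℝ) / ((p : ℕ) : ℝ)))
    (α : ℝ) (hα1 : 1 < α) (hαZ : α ∉ Set.range ((↑) : ℤ → ℝ)) :
    ∀ δ > 0, ∃ x ∈ Submonoid.closure ((((↑) : ℕ → ℝ) '' P) ∪ {α}),
      ∃ y ∈ Submonoid.closure ((((↑) : ℕ → ℝ) '' P) ∪ {α}),
        x ≠ y ∧ |x - y| < δ := by
  intro δ hδ
  by_cases hirr : Irrational α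
  · obtain ⟨m, n, hm, hn, hmP, hnP, hlt⟩ := irrational_case P hsum α hα1 hirr δ hδ
    refine ⟨m, mem_closure_of_primes P α m hm hmP, α * n,
      mul_mem (Submonoid.subset_closure (Or.inr rfl)) (mem_closure_of_primes P α n hn hnP),
      ?_, hlt⟩
    intro h
    exact (hirr.mul_natCast hn).ne_nat m h.symm
  · obtain ⟨x, rfl⟩ := not_not.1 hirr
    have hx1 : 1 < x := by exact_mod_cast hα1
    have hnum : 0 < x.num := Rat.num_pos.2 (by linarith)
    have hden : 1 < x.den := by
      rcases Nat.lt_or_ge 1 x.den with h | h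
      · exact h
      · exfalso
        have h1 : x.den = 1 := le_antisymm h x.den_pos
        apply hαZ
        refine ⟨x.num, ?_⟩
        have := Rat.coe_int_num_of_den_eq_one h1
        exact_mod_cast this
    have hxe : (x : ℝ) = (x.num.natAbs : ℝ) / (x.den : ℝ) := by
      rw [Rat.cast_def, Nat.cast_natAbs, abs_of_pos hnum]
    obtain ⟨m, n, k, hm, hn, hmP, hnP, hne, hlt⟩ := rational_case P hsum x.num.natAbs x.den
      (by omega) hden x.reduced δ hδ
    rw [← hxe] at hne hlt
    have hmem : (x : ℝ) ∈ Submonoid.closure ((((↑) : ℕ → ℝ) '' P) ∪ {(x : ℝ)}) :=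
      Submonoid.subset_closure (Or.inr rfl)
    exact ⟨m, mem_closure_of_primes P _ m hm hmP, (x : ℝ) ^ k * n,
      mul_mem (pow_mem hmem k)
        (mem_closure_of_primes P _ n hn hnP), hne, hlt⟩
end

section
/- Let E be a set of prime numbers with the sum of 1/p over p ∈ E finite, and let α > 1 be an irrational real number. Then for every δ > 0 there exist positive integers M and N, neither of which is divisible by any prime in E, such that |α·M − N| < δ. -/
lemma aux_shift (θ : ℝ) (h : Irrational θ) (J : ℕ) (x : ℕ → ℝ) (ε : ℝ) (hε : 0 < ε) :
    ∃ (c : ℝ) (T : ℕ) (t : ℕ → ℕ), (∀ j < J, t j ≤ T) ∧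
      ∀ j < J, ∃ n : ℤ, |(t j : ℝ) * θ - x j - c - n| < ε := by
  have hd : Dense (AddSubgroup.closure {θ, 1} : Set ℝ) :=
    dense_addSubgroupClosure_pair_iff.2 (by simpa using h)
  have h1 : ∀ y : ℝ, ∃ t n : ℤ, |(t : ℝ) * θ - y - n| < ε := by
    intro y
    obtain ⟨z, hz, hyz⟩ := Metric.dense_iff.1 hd y ε hε
    obtain ⟨a, b, hab⟩ := AddSubgroup.mem_closure_pair.1 hyz
    refine ⟨a, -b, ?_⟩
    rw [Metric.mem_ball, Real.dist_eq, ← hab] at hz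
    simp only [zsmul_eq_mul, mul_one] at hz
    convert hz using 2
    push_cast; ring
  choose s n hs using fun j => h1 (x j)
  let O : ℕ := ∑ j ∈ Finset.range J, (s j).natAbs
  have hO : ∀ j < J, (s j).natAbs ≤ O := fun j hj =>
    Finset.single_le_sum (f := fun j => (s j).natAbs) (fun _ _ => Nat.zero_le _)
      (Finset.mem_range.2 hj)
  refine ⟨O * θ, 2 * O, fun j => (s j + O).toNat, fun j hj => ?_, fun j hj => ⟨n j, ?_⟩⟩
  · have := hO j hj
    show (s j + (O : ℤ)).toNat ≤ 2 * O
    omega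
  · have := hO j hj
    have h2 : (((s j + O).toNat : ℤ)) = s j + O := by omega
    have h3 : (((s j + O).toNat : ℝ)) = s j + O := by exact_mod_cast h2
    rw [h3]
    convert hs j using 2
    ring

open Classical in
lemma aux_upper (θ : ℝ) (h : Irrational θ) (β η : ℝ) (hη : 0 < η) (hη1 : 3 * η ≤ 1) :
    ∃ K0 : ℕ, ∀ K ≥ K0,
      (((Finset.range K).filter (fun k : ℕ => ∃ n : ℤ, |(k : ℝ) * θ + β - n| < η)).card : ℝ)
        ≤ 12 * η * K := by
  set J : ℕ := ⌊1 / (3 * η)⌋₊ with hJ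
  have hJ1 : (J : ℝ) * (3 * η) ≤ 1 := by
    have := Nat.floor_le (show 0 ≤ 1 / (3 * η) by positivity)
    rw [← hJ, le_div_iff₀ (by positivity)] at this
    exact this
  have hJ2 : 1 ≤ (J : ℝ) * (6 * η) := by
    have h1 : 1 ≤ J := by
      rw [hJ, Nat.one_le_floor_iff, le_div_iff₀ (by positivity)]; linarith
    have h2 := Nat.lt_floor_add_one (1 / (3 * η))
    rw [← hJ, div_lt_iff₀ (by positivity)] at h2
    have h1' : (1 : ℝ) ≤ J := by exact_mod_cast h1
    nlinarith
  obtain ⟨c, T, t, htT, ht⟩ := aux_shift θ h J (fun j => j * (3 * η)) (η / 2) (by positivity)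
  refine ⟨T, fun K hK => ?_⟩
  set A := (Finset.range K).filter (fun k : ℕ => ∃ n : ℤ, |(k : ℝ) * θ + β - n| < η) with hA
  have hcard : A.card * J ≤ K + T := by
    have : (A ×ˢ Finset.range J).card ≤ (Finset.range (K + T)).card := by
      apply Finset.card_le_card_of_injOn (fun q => q.1 + t q.2)
      · rintro ⟨k, j⟩ hq
        simp only [hA, Finset.coe_product, Set.mem_prod, Finset.mem_coe, Finset.mem_filter,
          Finset.mem_range] at hq ⊢
        have := htT j hq.2
        omega
      · rintro ⟨k, j⟩ hq ⟨k', j'⟩ hq' heq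
        simp only [hA, Finset.coe_product, Set.mem_prod, Finset.mem_coe, Finset.mem_filter,
          Finset.mem_range] at hq hq' heq
        obtain ⟨⟨-, n, hn⟩, hj⟩ := hq
        obtain ⟨⟨-, n', hn'⟩, hj'⟩ := hq'
        have hjj : j = j' := by
          obtain ⟨m, hm⟩ := ht j hj
          obtain ⟨m', hm'⟩ := ht j' hj'
          have e : (k : ℝ) + t j = k' + t j' := by exact_mod_cast heq
          have e2 : (k : ℝ) * θ + t j * θ = k' * θ + t j' * θ := by
            rw [← add_mul, e, add_mul]
          rw [abs_lt] at hn hn' hm hm'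
          set N : ℤ := n + m - n' - m' with hN
          have hNr : (N : ℝ) = n + m - n' - m' := by rw [hN]; push_cast; ring
          have k1 : ((j : ℝ) - j') * (3 * η) + N < 3 * η := by rw [hNr]; linarith
          have k2 : -(3 * η) < ((j : ℝ) - j') * (3 * η) + N := by rw [hNr]; linarith
          have a1 : (j : ℝ) + 1 ≤ J := by exact_mod_cast hj
          have a2 : (j' : ℝ) + 1 ≤ J := by exact_mod_cast hj'
          have a3 : (0 : ℝ) ≤ j := by positivity
          have a4 : (0 : ℝ) ≤ j' := by positivity
          have N1 : N < 1 := by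
            have : (N : ℝ) < 1 := by nlinarith
            exact_mod_cast this
          have N2 : -1 < N := by
            have : (-1 : ℝ) < N := by nlinarith
            exact_mod_cast this
          have N0 : N = 0 := by omega
          rw [N0] at k1 k2
          simp only [Int.cast_zero, add_zero] at k1 k2
          have b1 : (j : ℝ) - j' < 1 := by nlinarith
          have b2 : -1 < (j : ℝ) - j' := by nlinarith
          have b1' : j < j' + 1 := by
            have : (j : ℝ) < j' + 1 := by linarith
            exact_mod_cast this
          have b2' : j' < j + 1 := by
            have : (j' : ℝ) < j + 1 := by linarith
            exact_mod_cast this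
          omega
        subst hjj
        simp at heq
        simp [heq]
    simpa using this
  have h1 : (A.card : ℝ) * J ≤ K + T := by exact_mod_cast hcard
  have h2 : (T : ℝ) ≤ K := by exact_mod_cast hK
  calc (A.card : ℝ) ≤ A.card * (J * (6 * η)) := le_mul_of_one_le_right (by positivity) hJ2
    _ = (A.card * J) * (6 * η) := by ring
    _ ≤ (K + T) * (6 * η) := by gcongr
    _ ≤ (K + K) * (6 * η) := by gcongr
    _ = _ := by ring

open Classical in
lemma aux_lower (θ : ℝ) (h : Irrational θ) (β η : ℝ) (hη : 0 < η) (hη1 : η ≤ 1) :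
    ∃ K0 : ℕ, ∀ K ≥ K0, η * K / 6 ≤
      (((Finset.range K).filter (fun k : ℕ => ∃ n : ℤ, |(k : ℝ) * θ + β - n| < η)).card : ℝ) := by
  set J : ℕ := ⌈2 / η⌉₊ with hJ
  have hJ1 : 2 ≤ (J : ℝ) * η := by
    have := Nat.le_ceil (2 / η)
    rwa [← hJ, div_le_iff₀ hη] at this
  have hJ2 : (J : ℝ) * η ≤ 3 := by
    have := (Nat.ceil_lt_add_one (show 0 ≤ 2 / η by positivity)).le
    rw [← hJ] at this
    calc (J : ℝ) * η ≤ (2 / η + 1) * η := by gcongr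
      _ = 2 + η := by field_simp
      _ ≤ 3 := by linarith
  obtain ⟨c, T, t, htT, ht⟩ := aux_shift θ h J (fun j => j * (η / 2)) (η / 2) (by positivity)
  refine ⟨2 * T, fun K hK => ?_⟩
  set A := (Finset.range K).filter (fun k : ℕ => ∃ n : ℤ, |(k : ℝ) * θ + β - n| < η) with hA
  have hcard : K - T ≤ A.card * J := by
    have key : ∀ k : ℕ, ∃ j < J, ∃ n : ℤ, |((k + t j : ℕ) : ℝ) * θ + β - n| < η := by
      intro k
      set u := Int.fract (-(k * θ + β + c)) with hu
      have u0 := Int.fract_nonneg (-(k * θ + β + c))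
      have u1 := Int.fract_lt_one (-(k * θ + β + c))
      have ue := Int.floor_add_fract (-(k * θ + β + c))
      rw [← hu] at u0 u1 ue
      have f1 := Nat.floor_le (show 0 ≤ u / (η / 2) by positivity)
      have f2 := Nat.lt_floor_add_one (u / (η / 2))
      set j := ⌊u / (η / 2)⌋₊ with hj
      rw [le_div_iff₀ (by positivity)] at f1
      rw [div_lt_iff₀ (by positivity)] at f2
      have hjJ : j < J := by
        have : (j : ℝ) < J := by nlinarith
        exact_mod_cast this
      obtain ⟨n, hn⟩ := ht j hjJ
      refine ⟨j, hjJ, n - ⌊-(k * θ + β + c)⌋, ?_⟩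
      rw [abs_lt] at hn ⊢
      push_cast
      constructor <;> nlinarith
    choose g hg n hn using key
    have : (Finset.range (K - T)).card ≤ (A ×ˢ Finset.range J).card := by
      apply Finset.card_le_card_of_injOn (fun k => (k + t (g k), g k))
      · intro k hk
        simp only [hA, Finset.coe_product, Set.mem_prod, Finset.mem_coe, Finset.mem_filter,
          Finset.mem_range] at hk ⊢
        have := htT _ (hg k)
        exact ⟨⟨by omega, n k, hn k⟩, hg k⟩
      · intro k _ k' _ heq
        simp only [Prod.mk.injEq] at heq
        rw [heq.2] at heq
        omega
    simpa using this
  have h1 : (K : ℝ) - T ≤ A.card * J := by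
    have : K ≤ A.card * J + T := by omega
    have : (K : ℝ) ≤ A.card * J + T := by exact_mod_cast this
    linarith
  have h2 : 2 * (T : ℝ) ≤ K := by exact_mod_cast hK
  have h3 : (K : ℝ) / 2 * η ≤ A.card * 3 := calc
    (K : ℝ) / 2 * η ≤ (A.card * J) * η := by
          apply mul_le_mul_of_nonneg_right _ hη.le; linarith
    _ = A.card * (J * η) := by ring
    _ ≤ _ := by gcongr
  linarith

lemma aux_res (P p : ℕ) (hp : p.Prime) (hc : Nat.Coprime p P) :
    ∃ r : ℤ, 0 ≤ r ∧ r < p ∧ ∀ m : ℤ, (p : ℤ) ∣ 1 + P * m → ∃ k : ℤ, m = r + p * k := by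
  have hp0 : (0 : ℤ) < p := by exact_mod_cast hp.pos
  by_cases h : ∃ m0 : ℤ, (p : ℤ) ∣ 1 + P * m0
  · obtain ⟨m0, h0⟩ := h
    refine ⟨m0 % p, Int.emod_nonneg _ hp0.ne', Int.emod_lt_of_pos _ hp0, fun m hm => ?_⟩
    have h1 : (p : ℤ) ∣ P * (m - m0) := by
      have h3 := dvd_sub hm h0
      have e : 1 + (P : ℤ) * m - (1 + P * m0) = P * (m - m0) := by ring
      rwa [e] at h3
    have h2 : (p : ℤ) ∣ m - m0 :=
      IsCoprime.dvd_of_dvd_mul_left (Nat.isCoprime_iff_coprime.2 hc) h1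
    obtain ⟨k, hk⟩ := h2
    refine ⟨k + m0 / p, ?_⟩
    have := Int.emod_add_mul_ediv m0 p
    linear_combination hk - this
  · exact ⟨0, le_rfl, hp0, fun m hm => absurd ⟨m, hm⟩ h⟩

open Classical in
/-- The indices `m < X` whose pair is bad at `p`. -/
noncomputable def auxBad (α β η : ℝ) (P X p : ℕ) : Finset ℕ :=
  (Finset.range X).filter (fun m : ℕ => ∃ n : ℤ, |(m : ℝ) * α + β - n| < η ∧
    ((p : ℤ) ∣ 1 + P * (m : ℤ) ∨ (p : ℤ) ∣ 1 + P * n))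

open Classical in
lemma aux_mid (α β η : ℝ) (h : Irrational α) (hη : 0 < η) (hη1 : 3 * η ≤ 1) (P p : ℕ)
    (hp : p.Prime) (hc : Nat.Coprime p P) :
    ∃ K0 : ℕ, ∀ X ≥ K0, ((auxBad α β η P X p).card : ℝ) ≤ 36 * η * X * (1 / (p : ℝ)) := by
  obtain ⟨r, hr0, hrp, hr⟩ := aux_res P p hp hc
  have hpos : (0 : ℝ) < p := by exact_mod_cast hp.pos
  have hp1 : (1 : ℝ) ≤ p := by exact_mod_cast hp.one_lt.le
  obtain ⟨K1, hK1⟩ := aux_upper (α * p) (h.mul_natCast hp.ne_zero) (α * r + β) η hη hη1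
  obtain ⟨K2, hK2⟩ := aux_upper (α / p) (h.div_natCast hp.ne_zero) ((β - r) / p) (η / p)
    (by positivity) (by
      rw [← mul_div_assoc, div_le_one hpos]; linarith)
  refine ⟨p * K1 + K2 + p, fun X hX => ?_⟩
  have hX1 : K1 ≤ X / p + 1 := by
    have : K1 ≤ X / p := (Nat.le_div_iff_mul_le hp.pos).2 (by nlinarith)
    omega
  have hX2 : K2 ≤ X := by nlinarith
  have hX3 : p ≤ X := by nlinarith
  specialize hK1 _ hX1
  specialize hK2 _ hX2
  set S1 := (Finset.range (X / p + 1)).filter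
    (fun k : ℕ => ∃ n : ℤ, |(k : ℝ) * (α * p) + (α * r + β) - n| < η) with hS1
  set S2 := (Finset.range X).filter
    (fun k : ℕ => ∃ n : ℤ, |(k : ℝ) * (α / p) + (β - r) / p - n| < η / p) with hS2
  have hsub : auxBad α β η P X p ⊆ S1.image (fun k => r.toNat + p * k) ∪ S2 := by
    intro m hm
    simp only [auxBad, Finset.mem_filter, Finset.mem_range] at hm
    obtain ⟨hmX, n, hn, hd | hd⟩ := hm
    · obtain ⟨k, hk⟩ := hr _ hd
      apply Finset.mem_union_left
      have hk0 : 0 ≤ k := by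
        by_contra hneg
        have : k ≤ -1 := by omega
        have : (p : ℤ) * k ≤ p * (-1) := by gcongr
        omega
      lift k to ℕ using hk0
      lift r to ℕ using hr0
      have hk' : m = r + p * k := by exact_mod_cast hk
      rw [Finset.mem_image]
      refine ⟨k, ?_, by simp [hk']⟩
      rw [hS1, Finset.mem_filter, Finset.mem_range]
      refine ⟨?_, n, ?_⟩
      · have : k ≤ X / p := (Nat.le_div_iff_mul_le hp.pos).2 (by nlinarith)
        omega
      · convert hn using 2
        rw [hk']; push_cast; ring
    · obtain ⟨k, hk⟩ := hr _ hd
      apply Finset.mem_union_right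
      rw [hS2, Finset.mem_filter, Finset.mem_range]
      refine ⟨hmX, k, ?_⟩
      have e : (m : ℝ) * (α / p) + (β - r) / p - k = ((m : ℝ) * α + β - n) / p := by
        rw [hk]; push_cast; field_simp; ring
      rw [e, abs_div, abs_of_pos hpos]
      gcongr
  have hc1 : (auxBad α β η P X p).card ≤ S1.card + S2.card :=
    (Finset.card_le_card hsub).trans ((Finset.card_union_le _ _).trans
      (Nat.add_le_add_right Finset.card_image_le _))
  have hc2 : ((auxBad α β η P X p).card : ℝ) ≤ S1.card + S2.card := by exact_mod_cast hc1
  have hq : ((X / p + 1 : ℕ) : ℝ) ≤ 2 * (X / p) := by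
    have a : ((X / p : ℕ) : ℝ) ≤ X / p := Nat.cast_div_le
    have b : (1 : ℝ) ≤ X / p := by
      rw [le_div_iff₀ hpos, one_mul]; exact_mod_cast hX3
    push_cast; linarith
  calc ((auxBad α β η P X p).card : ℝ) ≤ S1.card + S2.card := hc2
    _ ≤ 12 * η * (X / p + 1 : ℕ) + 12 * (η / p) * X := add_le_add hK1 hK2
    _ ≤ 12 * η * (2 * (X / p)) + 12 * (η / p) * X := by gcongr
    _ = _ := by ring

/-- Size bounds for a pair `(M, N) = (1 + P m, 1 + P n)`. -/
lemma aux_size (α δ : ℝ) (hα : 1 < α) (hδ1 : 3 * δ ≤ 1) (P X m : ℕ)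
    (hP : 0 < P) (hm : m < X) (n : ℤ)
    (hn : |(m : ℝ) * α + (α - 1) / P - n| < δ / P) :
    |α * (1 + P * m) - (1 + P * n)| < δ ∧ 0 < 1 + (P : ℤ) * n ∧
      (1 + (P : ℝ) * m) ≤ P * X ∧ (1 + (P : ℝ) * n) ≤ 2 * α * P * X := by
  have hP0 : (0 : ℝ) < P := by exact_mod_cast hP
  have hP1 : (1 : ℝ) ≤ P := by exact_mod_cast hP
  have h1 : |α * (1 + P * m) - (1 + P * n)| < δ := by
    have e : α * (1 + P * m) - (1 + P * n) = ((m : ℝ) * α + (α - 1) / P - n) * P := by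
      field_simp; ring
    rw [e, abs_mul, abs_of_pos hP0]
    rwa [lt_div_iff₀ hP0] at hn
  have hmX : (m : ℝ) + 1 ≤ X := by exact_mod_cast hm
  have hm0 : (0 : ℝ) ≤ m := by positivity
  have hM : (1 + (P : ℝ) * m) ≤ P * X := by nlinarith
  have hM1 : 1 ≤ 1 + (P : ℝ) * m := by have := mul_nonneg hP0.le hm0; linarith
  have h2 := abs_lt.1 h1
  refine ⟨h1, ?_, hM, ?_⟩
  · have : (0 : ℝ) < 1 + P * n := by nlinarith
    exact_mod_cast this
  · have h3 : α * (1 + P * m) ≤ α * (P * X) := by gcongr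
    have h4 : 1 ≤ α * (P * X) := by nlinarith
    nlinarith

open Classical in
lemma aux_large (α δ : ℝ) (hα : 1 < α) (hδ1 : 3 * δ ≤ 1) (P X p : ℕ)
    (hP : 0 < P) (hp : 0 < p) :
    ((auxBad α ((α - 1) / P) (δ / P) P X p).card : ℝ) ≤ 3 * α * P * X * (1 / (p : ℝ)) := by
  have hP0 : (0 : ℝ) < P := by exact_mod_cast hP
  have hP1 : (1 : ℝ) ≤ P := by exact_mod_cast hP
  have hpos : (0 : ℝ) < p := by exact_mod_cast hp
  have hpz : (0 : ℤ) < p := by exact_mod_cast hp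
  set S1 := (Finset.range X).filter (fun m : ℕ => (p : ℤ) ∣ 1 + P * (m : ℤ)) with hS1
  set S2 := (Finset.range X).filter (fun m : ℕ => ∃ n : ℤ,
    |(m : ℝ) * α + (α - 1) / P - n| < δ / P ∧ (p : ℤ) ∣ 1 + P * n) with hS2
  have hsub : auxBad α ((α - 1) / P) (δ / P) P X p ⊆ S1 ∪ S2 := by
    intro m hm
    simp only [auxBad, Finset.mem_filter, Finset.mem_range] at hm
    obtain ⟨hmX, n, hn, hd | hd⟩ := hm
    · exact Finset.mem_union_left _ (by simp [hS1, hmX, hd])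
    · exact Finset.mem_union_right _ (by
        rw [hS2, Finset.mem_filter, Finset.mem_range]; exact ⟨hmX, n, hn, hd⟩)
  have hc1 : (auxBad α ((α - 1) / P) (δ / P) P X p).card ≤ S1.card + S2.card :=
    (Finset.card_le_card hsub).trans (Finset.card_union_le _ _)
  have hc2 : ((auxBad α ((α - 1) / P) (δ / P) P X p).card : ℝ) ≤ S1.card + S2.card := by
    exact_mod_cast hc1
  have b1 : (S1.card : ℝ) ≤ P * X / p := by
    have : S1.card ≤ (Finset.Icc 1 (P * X / p)).card := by
      apply Finset.card_le_card_of_injOn (fun m => (1 + P * m) / p)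
      · intro m hm
        simp only [hS1, Finset.coe_filter, Set.mem_ofPred_eq, Finset.mem_range] at hm
        have hd : p ∣ 1 + P * m := by exact_mod_cast hm.2
        simp only [Finset.coe_Icc, Set.mem_Icc]
        constructor
        · exact Nat.div_pos (Nat.le_of_dvd (by positivity) hd) hp
        · apply Nat.div_le_div_right
          have := hm.1
          nlinarith
      · intro m hm m' hm' heq
        simp only [hS1, Finset.coe_filter, Set.mem_ofPred_eq, Finset.mem_range] at hm hm' heq
        have hd : p ∣ 1 + P * m := by exact_mod_cast hm.2
        have hd' : p ∣ 1 + P * m' := by exact_mod_cast hm'.2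
        have := (Nat.div_left_inj hd hd').1 heq
        exact Nat.eq_of_mul_eq_mul_left hP (by omega)
    have h2 : (S1.card : ℝ) ≤ ((P * X / p : ℕ) : ℝ) := by
      have : S1.card ≤ P * X / p := by simpa using this
      exact_mod_cast this
    refine h2.trans ((Nat.cast_div_le).trans ?_)
    push_cast; rfl
  have b2 : (S2.card : ℝ) ≤ 2 * α * P * X / p := by
    have hex : ∀ m : ℕ, ∃ k : ℕ, m ∈ S2 → ∃ n : ℤ,
        |(m : ℝ) * α + (α - 1) / P - n| < δ / P ∧ 1 + P * n = p * (k : ℤ) := by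
      intro m
      by_cases hm : m ∈ S2
      · rw [hS2, Finset.mem_filter, Finset.mem_range] at hm
        obtain ⟨hmX, n, hn, k, hk⟩ := hm
        have hs := (aux_size α δ hα hδ1 P X m hP hmX n hn).2.1
        have hk0 : 0 ≤ k := by
          rw [hk] at hs
          exact (pos_of_mul_pos_right hs hpz.le).le
        lift k to ℕ using hk0
        exact ⟨k, fun _ => ⟨n, hn, hk⟩⟩
      · exact ⟨0, fun h => absurd h hm⟩
    choose g hg using hex
    have : S2.card ≤ (Finset.Icc 1 ⌊2 * α * P * X / p⌋₊).card := by
      apply Finset.card_le_card_of_injOn g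
      · intro m hm
        obtain ⟨n, hn, hk⟩ := hg m hm
        have hmX : m < X := by
          have hm' : m ∈ S2 := hm
          rw [hS2, Finset.mem_filter, Finset.mem_range] at hm'
          exact hm'.1
        obtain ⟨-, h0, -, h1⟩ := aux_size α δ hα hδ1 P X m hP hmX n hn
        simp only [Finset.coe_Icc, Set.mem_Icc]
        constructor
        · rw [hk] at h0
          have := pos_of_mul_pos_right h0 hpz.le
          omega
        · apply Nat.le_floor
          rw [le_div_iff₀ hpos]
          have hk' : (1 : ℝ) + P * n = p * g m := by exact_mod_cast hk
          rw [hk'] at h1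
          linarith
      · intro m hm m' hm' heq
        have hmX : ∀ m ∈ S2, m < X := by
          intro m hm
          rw [hS2, Finset.mem_filter, Finset.mem_range] at hm
          exact hm.1
        obtain ⟨n, hn, hk⟩ := hg m hm
        obtain ⟨n', hn', hk'⟩ := hg m' hm'
        have h1 := (aux_size α δ hα hδ1 P X m hP (hmX m hm) n hn).1
        have h2 := (aux_size α δ hα hδ1 P X m' hP (hmX m' hm') n' hn').1
        have e : (1 : ℝ) + P * n = 1 + P * n' := by
          rw [heq, ← hk'] at hk
          exact_mod_cast hk
        rw [e] at h1
        rw [abs_lt] at h1 h2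
        have hαP : 1 < α * P := by nlinarith
        have c1 : (m : ℝ) < m' + 1 := by
          by_contra hcon
          push Not at hcon
          nlinarith
        have c2 : (m' : ℝ) < m + 1 := by
          by_contra hcon
          push Not at hcon
          nlinarith
        have c1' : m < m' + 1 := by exact_mod_cast c1
        have c2' : m' < m + 1 := by exact_mod_cast c2
        omega
    have h2 : S2.card ≤ ⌊2 * α * P * X / p⌋₊ := by simpa using this
    exact (Nat.le_floor_iff (by positivity)).1 h2
  calc ((auxBad α ((α - 1) / P) (δ / P) P X p).card : ℝ) ≤ S1.card + S2.card := hc2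
    _ ≤ P * X / p + 2 * α * P * X / p := add_le_add b1 b2
    _ = (1 + 2 * α) * (P * X * (1 / p)) := by ring
    _ ≤ (3 * α) * (P * X * (1 / p)) := by gcongr; linarith
    _ = _ := by ring

theorem stmt_7 (E : Set ℕ) (hE : ∀ p ∈ E, p.Prime)
    (hsum : Summable (fun p : E => (1 : ℝ) / ((p : ℕ) : ℝ)))
    (α : ℝ) (hα : 1 < α) (hirr : Irrational α) :
    ∀ δ > 0, ∃ M N : ℕ, 0 < M ∧ 0 < N ∧
      (∀ p ∈ E, ¬ p ∣ M) ∧ (∀ p ∈ E, ¬ p ∣ N) ∧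
      |α * (M : ℝ) - (N : ℝ)| < δ := by
  classical
  intro δ0 hδ0
  obtain ⟨δ, hδ, hδ1, hδ2⟩ : ∃ δ : ℝ, 0 < δ ∧ 3 * δ ≤ 1 ∧ δ ≤ δ0 :=
    ⟨min δ0 (1 / 3), by positivity, by linarith [min_le_right δ0 (1 / 3)], min_le_left _ _⟩
  set f : ℕ → ℝ := fun p => 1 / (p : ℝ) with hf
  have hs : Summable (E.indicator f) := by
    rw [← summable_subtype_iff_indicator]; exact hsum
  rw [summable_iff_vanishing_norm] at hs
  have hv : ∀ ε > 0, ∃ s : Finset ℕ, ∀ t : Finset ℕ, (∀ p ∈ t, p ∈ E ∧ p ∉ s) →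
      ∑ p ∈ t, f p < ε := by
    intro ε hε
    obtain ⟨s, h⟩ := hs ε hε
    refine ⟨s, fun t ht => ?_⟩
    have h1 := h t (Finset.disjoint_left.2 fun p hp => (ht p hp).2)
    have h2 : ∑ p ∈ t, E.indicator f p = ∑ p ∈ t, f p :=
      Finset.sum_congr rfl fun p hp => Set.indicator_of_mem (ht p hp).1 f
    rw [h2] at h1
    exact (le_abs_self _).trans_lt h1
  obtain ⟨S1, hS1⟩ := hv (1 / 864) (by norm_num)
  set P : ℕ := ∏ p ∈ S1.filter (· ∈ E), p with hPdef
  have hP : 0 < P := Finset.prod_pos fun p hp => (hE p (Finset.mem_filter.1 hp).2).pos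
  have hP0 : (0 : ℝ) < P := by exact_mod_cast hP
  have hP1 : (1 : ℝ) ≤ P := by exact_mod_cast hP
  have hdvd : ∀ p ∈ E, p ∈ S1 → p ∣ P := fun p hp hp1 =>
    Finset.dvd_prod_of_mem (fun p => p) (Finset.mem_filter.2 ⟨hp1, hp⟩)
  have hcop : ∀ p ∈ E, p ∉ S1 → Nat.Coprime p P := by
    intro p hp hp1
    refine Nat.Coprime.prod_right fun q hq => ?_
    rw [Finset.mem_filter] at hq
    exact (Nat.coprime_primes (hE p hp) (hE q hq.2)).2 (fun h => hp1 (h ▸ hq.1))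
  set η : ℝ := δ / P with hηdef
  set β : ℝ := (α - 1) / P with hβdef
  have hη : 0 < η := by positivity
  have hηδ : η ≤ δ := div_le_self hδ.le hP1
  obtain ⟨S2, hS2⟩ := hv (η / (72 * α * P)) (by positivity)
  obtain ⟨K0, hK0⟩ := aux_lower α hirr β η hη (by linarith)
  have hmid : ∀ p : ℕ, ∃ K : ℕ, p ∈ E → p ∉ S1 → ∀ X ≥ K,
      ((auxBad α β η P X p).card : ℝ) ≤ 36 * η * X * f p := by
    intro p
    by_cases hp : p ∈ E ∧ p ∉ S1
    · obtain ⟨K, hK⟩ := aux_mid α β η hirr hη (by linarith) P p (hE p hp.1) (hcop p hp.1 hp.2)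
      exact ⟨K, fun _ _ => hK⟩
    · exact ⟨0, fun h1 h2 => absurd ⟨h1, h2⟩ hp⟩
  choose K hK using hmid
  set X : ℕ := K0 + ∑ p ∈ S2, K p + 1 with hX
  have hXK : ∀ p ∈ S2, K p ≤ X := fun p hp => by
    have := Finset.single_le_sum (f := K) (fun _ _ => Nat.zero_le _) hp
    omega
  have hX0 : (0 : ℝ) < X := by
    have : 0 < X := by omega
    exact_mod_cast this
  have hlow := hK0 X (by omega)
  set A := (Finset.range X).filter (fun k : ℕ => ∃ n : ℤ, |(k : ℝ) * α + β - n| < η) with hA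
  set Y : ℕ := ⌊2 * α * P * X⌋₊ with hY
  set U1 := S2.filter (fun p => p ∈ E ∧ p ∉ S1) with hU1
  set U2 := (Finset.range (Y + 1)).filter (fun p => p ∈ E ∧ p ∉ S2) with hU2
  by_contra hcon
  have hsub : A ⊆ U1.biUnion (auxBad α β η P X) ∪ U2.biUnion (auxBad α β η P X) := by
    intro m hm
    rw [hA, Finset.mem_filter, Finset.mem_range] at hm
    obtain ⟨hmX, n, hn⟩ := hm
    obtain ⟨h1, h2, h3, h4⟩ := aux_size α δ hα hδ1 P X m hP hmX n hn
    have hbad : ∃ p ∈ E, (p : ℤ) ∣ 1 + P * (m : ℤ) ∨ (p : ℤ) ∣ 1 + P * n := by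
      by_contra hno
      push Not at hno
      apply hcon
      obtain ⟨N, hN⟩ := Int.eq_ofNat_of_zero_le h2.le
      refine ⟨1 + P * m, N, by omega, by omega, fun p hp hd => (hno p hp).1 ?_,
        fun p hp hd => (hno p hp).2 ?_, ?_⟩
      · exact_mod_cast hd
      · rw [hN]; exact_mod_cast hd
      · have e : (1 : ℝ) + P * n = N := by exact_mod_cast hN
        rw [e] at h1
        push_cast
        linarith
    obtain ⟨p, hp, hd⟩ := hbad
    have hpS1 : p ∉ S1 := by
      intro hps
      have hpP : (p : ℤ) ∣ P := by exact_mod_cast hdvd p hp hps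
      have : (p : ℤ) ∣ 1 := by
        rcases hd with hd | hd
        · exact (dvd_add_left (hpP.mul_right _)).1 hd
        · exact (dvd_add_left (hpP.mul_right _)).1 hd
      have : p ∣ 1 := by exact_mod_cast this
      exact (hE p hp).one_lt.ne' (Nat.dvd_one.1 this)
    have hmem : m ∈ auxBad α β η P X p := by
      rw [auxBad, Finset.mem_filter, Finset.mem_range]
      exact ⟨hmX, n, hn, hd⟩
    by_cases hpS2 : p ∈ S2
    · exact Finset.mem_union_left _ (Finset.mem_biUnion.2
        ⟨p, Finset.mem_filter.2 ⟨hpS2, hp, hpS1⟩, hmem⟩)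
    · refine Finset.mem_union_right _ (Finset.mem_biUnion.2
        ⟨p, Finset.mem_filter.2 ⟨?_, hp, hpS2⟩, hmem⟩)
      rw [Finset.mem_range, Nat.lt_succ_iff, hY]
      apply Nat.le_floor
      rcases hd with hd | hd
      · have := Int.le_of_dvd (by positivity) hd
        have : (p : ℝ) ≤ 1 + P * m := by exact_mod_cast this
        have h5 : (0 : ℝ) < P * X := by positivity
        nlinarith
      · have := Int.le_of_dvd h2 hd
        have : (p : ℝ) ≤ 1 + P * n := by exact_mod_cast this
        linarith
  have hcard : (A.card : ℝ) ≤ ∑ p ∈ U1, ((auxBad α β η P X p).card : ℝ)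
      + ∑ p ∈ U2, ((auxBad α β η P X p).card : ℝ) := by
    have : A.card ≤ ∑ p ∈ U1, (auxBad α β η P X p).card
      + ∑ p ∈ U2, (auxBad α β η P X p).card :=
      (Finset.card_le_card hsub).trans ((Finset.card_union_le _ _).trans
        (add_le_add Finset.card_biUnion_le Finset.card_biUnion_le))
    exact_mod_cast this
  have s1 : ∑ p ∈ U1, ((auxBad α β η P X p).card : ℝ) ≤ η * X / 24 := calc
    _ ≤ ∑ p ∈ U1, 36 * η * X * f p := Finset.sum_le_sum fun p hp => by
        rw [hU1, Finset.mem_filter] at hp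
        exact hK p hp.2.1 hp.2.2 X (hXK p hp.1)
    _ = 36 * η * X * ∑ p ∈ U1, f p := by rw [Finset.mul_sum]
    _ ≤ 36 * η * X * (1 / 864) := by
        gcongr
        exact (hS1 U1 fun p hp => (Finset.mem_filter.1 hp).2).le
    _ = _ := by ring
  have s2 : ∑ p ∈ U2, ((auxBad α β η P X p).card : ℝ) ≤ η * X / 24 := calc
    _ ≤ ∑ p ∈ U2, 3 * α * P * X * f p := Finset.sum_le_sum fun p hp => by
        rw [hU2, Finset.mem_filter] at hp
        exact aux_large α δ hα hδ1 P X p hP (hE p hp.2.1).pos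
    _ = 3 * α * P * X * ∑ p ∈ U2, f p := by rw [Finset.mul_sum]
    _ ≤ 3 * α * P * X * (η / (72 * α * P)) := by
        gcongr
        exact (hS2 U2 fun p hp => (Finset.mem_filter.1 hp).2).le
    _ = _ := by
        have : α ≠ 0 := by positivity
        field_simp; norm_num
  have : 0 < η * X := by positivity
  linarith
end

section
/- Let G′ be a set of real numbers with inf G′ > 1 and such that the sum of 1/√g over g ∈ G′ converges. Let B′ be the multiplicative submonoid of ℝ generated by G′. Then the sum of 1/√b over b ∈ B′ converges, and is at most the (convergent) product over g ∈ G′ of (1 + 1/(√g − 1)). -/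
noncomputable def wgt (x : ℝ) : ENNReal := ENNReal.ofReal (1 / Real.sqrt x)

lemma wgt_mul (x y : ℝ) (hx : 0 ≤ x) : wgt (x * y) = wgt x * wgt y := by
  unfold wgt
  rw [← ENNReal.ofReal_mul (by positivity), Real.sqrt_mul hx]
  congr 1
  rw [one_div_mul_one_div]

lemma wgt_pow (x : ℝ) (hx : 0 ≤ x) (k : ℕ) : wgt (x ^ k) = wgt x ^ k := by
  induction k with
  | zero => simp [wgt]
  | succ k ih => rw [pow_succ, wgt_mul _ _ (by positivity), ih, pow_succ]

lemma wgt_geom (x : ℝ) (hx : 1 < x) :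
    ∑' k : ℕ, wgt x ^ k = ENNReal.ofReal (1 + 1 / (Real.sqrt x - 1)) := by
  have h1 : 1 < Real.sqrt x := by
    rw [Real.lt_sqrt (by norm_num)]; simpa using hx
  have h2 : 1 / Real.sqrt x < 1 := by
    rw [div_lt_one (by linarith)]; exact h1
  rw [ENNReal.tsum_geometric, wgt, ← ENNReal.ofReal_one, ← ENNReal.ofReal_sub _ (by positivity),
    ← ENNReal.ofReal_inv_of_pos (by linarith)]
  congr 1
  have : Real.sqrt x - 1 ≠ 0 := by linarith
  have : Real.sqrt x ≠ 0 := by linarith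
  field_simp
  ring

lemma closure_bound (G : Set ℝ) (hG : ∀ g ∈ G, 1 < g) (S : Finset G) :
    ∑' b : Submonoid.closure (Subtype.val '' (S : Set G)), wgt b ≤
      ∏ g ∈ S, ENNReal.ofReal (1 + 1 / (Real.sqrt (g : ℝ) - 1)) := by
  classical
  induction S using Finset.induction_on with
  | empty =>
    rw [Finset.coe_empty, Set.image_empty, Submonoid.closure_empty, Finset.prod_empty]
    rw [tsum_eq_single (1 : (⊥ : Submonoid ℝ))]
    · simp [wgt]
    · intro b hb
      exact absurd (Subtype.ext (Submonoid.mem_bot.1 b.2)) hb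
  | insert g S hg ih =>
    rw [Finset.prod_insert hg]
    have hg1 := hG g g.2
    have key : ∀ b : Submonoid.closure (Subtype.val '' ((insert g S : Finset G) : Set G)),
        ∃ p : ℕ × Submonoid.closure (Subtype.val '' (S : Set G)), (b : ℝ) = (g : ℝ) ^ p.1 * p.2 := by
      rintro ⟨b, hb⟩
      rw [Finset.coe_insert, Set.image_insert_eq, Set.insert_eq, Submonoid.closure_union,
        Submonoid.mem_sup] at hb
      obtain ⟨y, hy, z, hz, rfl⟩ := hb
      obtain ⟨k, rfl⟩ := Submonoid.mem_closure_singleton.1 hy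
      exact ⟨(k, ⟨z, hz⟩), rfl⟩
    choose φ hφ using key
    have hinj : Function.Injective φ := by
      intro a b hab
      apply Subtype.ext
      rw [hφ a, hφ b, hab]
    calc _ = ∑' b, (fun p : ℕ × Submonoid.closure (Subtype.val '' (S : Set G)) =>
              wgt g ^ p.1 * wgt p.2) (φ b) := by
            apply tsum_congr
            intro b
            rw [hφ b, wgt_mul _ _ (by positivity), wgt_pow _ (by linarith)]
      _ ≤ ∑' p : ℕ × Submonoid.closure (Subtype.val '' (S : Set G)),
              wgt g ^ p.1 * wgt p.2 := ENNReal.tsum_comp_le_tsum_of_injective hinj _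
      _ = (∑' k : ℕ, wgt g ^ k) *
            ∑' b : Submonoid.closure (Subtype.val '' (S : Set G)), wgt b := by
            rw [ENNReal.tsum_prod', ← ENNReal.tsum_mul_right]
            apply tsum_congr
            intro k
            dsimp only
            rw [ENNReal.tsum_mul_left]
      _ ≤ _ := by
            rw [wgt_geom _ hg1]
            gcongr

lemma mem_fin (G : Set ℝ) (b : ℝ) (hb : b ∈ Submonoid.closure G) :
    ∃ S : Finset G, b ∈ Submonoid.closure (Subtype.val '' (S : Set G)) := by
  classical
  induction hb using Submonoid.closure_induction with
  | mem x hx => exact ⟨{⟨x, hx⟩}, Submonoid.subset_closure (by simp)⟩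
  | one => exact ⟨∅, one_mem _⟩
  | mul x y _ _ h1 h2 =>
    obtain ⟨S, hS⟩ := h1
    obtain ⟨T, hT⟩ := h2
    exact ⟨S ∪ T, mul_mem
      (Submonoid.closure_mono (Set.image_mono (by simp)) hS)
      (Submonoid.closure_mono (Set.image_mono (by simp)) hT)⟩

/-- The Euler-product estimate from the proof of Theorems 2 and 3: if `inf G' > 1` and
`∑_{g ∈ G'} 1/√g < ∞`, then for the generated multiplicative monoid `B'` the sum
`∑_{b ∈ B'} 1/√b` converges and is at most `∏_{g ∈ G'} (1 + 1/(√g − 1))`, which itself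
converges. -/
theorem stmt_10 (G' : Set ℝ) (hinf : 1 < sInf G')
    (hsum : Summable (fun g : G' => 1 / Real.sqrt (g : ℝ))) :
    Summable (fun b : (Submonoid.closure G' : Set ℝ) => 1 / Real.sqrt (b : ℝ)) ∧
    Multipliable (fun g : G' => 1 + 1 / (Real.sqrt (g : ℝ) - 1)) ∧
    (∑' b : (Submonoid.closure G' : Set ℝ), 1 / Real.sqrt (b : ℝ)) ≤
      ∏' g : G', (1 + 1 / (Real.sqrt (g : ℝ) - 1)) := by
  classical
  have hbdd : BddBelow G' := by
    by_contra h
    rw [Real.sInf_of_not_bddBelow h] at hinf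
    linarith
  have hm : ∀ g ∈ G', sInf G' ≤ g := fun g hg => csInf_le hbdd hg
  have hG : ∀ g ∈ G', 1 < g := fun g hg => hinf.trans_le (hm g hg)
  generalize sInf G' = m at hinf hm
  have hm1 : 1 < Real.sqrt m := by
    rw [Real.lt_sqrt (by norm_num)]; simpa using hinf
  have hgm : ∀ g : G', Real.sqrt m ≤ Real.sqrt (g : ℝ) := fun g => Real.sqrt_le_sqrt (hm g g.2)
  have hpos : ∀ g : G', 0 ≤ 1 / (Real.sqrt (g : ℝ) - 1) := fun g =>
    div_nonneg zero_le_one (by linarith [hgm g])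
  have hu : Summable (fun g : G' => 1 / (Real.sqrt (g : ℝ) - 1)) := by
    refine Summable.of_nonneg_of_le hpos (fun g => ?_)
      (hsum.mul_left (Real.sqrt m / (Real.sqrt m - 1)))
    have := hgm g
    rw [div_mul_div_comm, div_le_div_iff₀ (by linarith)
      (mul_pos (by linarith) (by linarith))]
    nlinarith
  have hmul : Multipliable (fun g : G' => 1 + 1 / (Real.sqrt (g : ℝ) - 1)) :=
    Real.multipliable_one_add_of_summable hu
  have hfin : ∀ T : Finset (Submonoid.closure G' : Set ℝ),
      ∑ b ∈ T, 1 / Real.sqrt (b : ℝ) ≤ ∏' g : G', (1 + 1 / (Real.sqrt (g : ℝ) - 1)) := by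
    intro T
    choose F hF using fun b : (Submonoid.closure G' : Set ℝ) => mem_fin G' b b.2
    let S := T.biUnion F
    have hS : ∀ b ∈ T, (b : ℝ) ∈ Submonoid.closure (Subtype.val '' (S : Set G')) := by
      intro b hb
      refine Submonoid.closure_mono (Set.image_mono ?_) (hF b)
      exact_mod_cast Finset.subset_biUnion_of_mem F hb
    have h1 : ∑ b ∈ T, wgt b ≤
        ∑' b : Submonoid.closure (Subtype.val '' (S : Set G')), wgt b := by
      rw [← Finset.sum_attach]
      let ψ : {x // x ∈ T} → Submonoid.closure (Subtype.val '' (S : Set G')) :=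
        fun b => ⟨b.1, hS b.1 b.2⟩
      have hψ : Function.Injective ψ := by
        intro a b hab
        apply Subtype.ext
        apply Subtype.ext
        exact congrArg (fun z : Submonoid.closure (Subtype.val '' (S : Set G')) => (z : ℝ)) hab
      refine le_trans (ENNReal.sum_le_tsum _) ?_
      exact ENNReal.tsum_comp_le_tsum_of_injective hψ (fun b => wgt b)
    have h2 := h1.trans (closure_bound G' hG S)
    rw [← ENNReal.ofReal_prod_of_nonneg (fun g _ => by linarith [hpos g])] at h2
    unfold wgt at h2
    rw [← ENNReal.ofReal_sum_of_nonneg (fun b _ => by positivity),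
      ENNReal.ofReal_le_ofReal_iff (Finset.prod_nonneg fun g _ => by linarith [hpos g])] at h2
    refine h2.trans ?_
    refine ge_of_tendsto hmul.hasProd ?_
    filter_upwards [Filter.eventually_ge_atTop S] with R hR
    exact Finset.prod_le_prod_of_subset_of_one_le hR (fun g _ => by linarith [hpos g])
      (fun g _ _ => by linarith [hpos g])
  have hs := summable_of_sum_le (fun b : (Submonoid.closure G' : Set ℝ) => by positivity) hfin
  exact ⟨hs, hmul, hs.tsum_le_of_sum_le hfin⟩
end
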